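/- For every k₀ > 0 there exist h₀ > 0 and R > 0 (depending only on A, F (through the constants in (F2), (F3)), the Lipschitz constant of G, ‖G(0)‖ and k₀) such that for every k ≥ k₀, every h ∈ (0,h₀], and every locally Lipschitz τ : W → [0,h], the delay system with M(φ) = G(φ(−τ(φ))) is dissipative: for every ρ > 0 there exists t_ρ ≥ 0 such that every global mild solution u with initial datum φ ∈ W satisfying |φ|_W ≤ ρ obeys ‖u̇(t)‖² + ⟨A u(t), u(t)⟩ ≤ R² for all t ≥ t_ρ. -/

import Mathlib

open Set Real MeasureTheory
open scoped RealInnerProductSpace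

noncomputable section

/-- Euclidean space `ℝⁿ`. -/
abbrev Euc (n : ℕ) := EuclideanSpace ℝ (Fin n)

/-- `(φ, φ')` is a `C¹` pair on `[-h,0]`: `φ'` is the (one-sided) derivative of `φ` on
`[-h,0]` and is continuous there. -/
def IsC1Pair (n : ℕ) (h : ℝ) (φ φ' : ℝ → Euc n) : Prop :=
  (∀ θ ∈ Icc (-h) (0:ℝ), HasDerivWithinAt φ (φ' θ) (Icc (-h) 0) θ) ∧
    ContinuousOn φ' (Icc (-h) 0)

/-- The norm of `W = C¹([-h,0];ℝⁿ)`: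
`|φ|_W = max_{θ∈[-h,0]} ‖φ(θ)‖ + max_{θ∈[-h,0]} ‖φ'(θ)‖`. -/
def Wnorm (n : ℕ) (h : ℝ) (φ φ' : ℝ → Euc n) : ℝ :=
  (⨆ θ : Icc (-h) (0:ℝ), ‖φ θ.1‖) + ⨆ θ : Icc (-h) (0:ℝ), ‖φ' θ.1‖

/-- A mild solution of `ü + k u̇ + A u + F(u) + M(u_t) = 0` on `[0,T)` with initial
datum `(φ, φ')`: `u` is `C¹` on `[-h,T)` with derivative `u'`, coincides with `φ` on
`[-h,0]`, and `u̇(t) = φ'(0) - ∫₀ᵗ (k u̇(s) + A u(s) + F(u(s)) + M(u_s)) ds` on `[0,T)`.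
Here `M` takes the segment `u_s` as a pair (the function and its derivative). -/
def IsMildSolOn (n : ℕ) (h k T : ℝ) (A : Euc n →L[ℝ] Euc n) (F : Euc n → Euc n)
    (M : (ℝ → Euc n) → (ℝ → Euc n) → Euc n) (φ φ' u u' : ℝ → Euc n) : Prop :=
  (∀ t ∈ Ico (-h) T, HasDerivWithinAt u (u' t) (Ico (-h) T) t) ∧
  ContinuousOn u' (Ico (-h) T) ∧
  (∀ θ ∈ Icc (-h) (0:ℝ), u θ = φ θ ∧ u' θ = φ' θ) ∧
  (∀ t ∈ Ico (0:ℝ) T, u' t = φ' 0 - ∫ s in (0:ℝ)..t,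
      (k • u' s + A (u s) + F (u s) + M (fun θ => u (s + θ)) (fun θ => u' (s + θ))))

/-- A global mild solution (on `[0,∞)`). -/
def IsGlobalMildSol (n : ℕ) (h k : ℝ) (A : Euc n →L[ℝ] Euc n) (F : Euc n → Euc n)
    (M : (ℝ → Euc n) → (ℝ → Euc n) → Euc n) (φ φ' u u' : ℝ → Euc n) : Prop :=
  (∀ t ∈ Ici (-h), HasDerivWithinAt u (u' t) (Ici (-h)) t) ∧
  ContinuousOn u' (Ici (-h)) ∧
  (∀ θ ∈ Icc (-h) (0:ℝ), u θ = φ θ ∧ u' θ = φ' θ) ∧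
  (∀ t ∈ Ici (0:ℝ), u' t = φ' 0 - ∫ s in (0:ℝ)..t,
      (k • u' s + A (u s) + F (u s) + M (fun θ => u (s + θ)) (fun θ => u' (s + θ))))

/-- Hypothesis (M1): local Lipschitz property of the delay term in the `W`-norm. -/
def HypM1 (n : ℕ) (h : ℝ) (M : (ℝ → Euc n) → (ℝ → Euc n) → Euc n) : Prop :=
  ∀ ρ > (0:ℝ), ∃ C > (0:ℝ), ∀ φ₁ φ₁' φ₂ φ₂' : ℝ → Euc n,
    IsC1Pair n h φ₁ φ₁' → IsC1Pair n h φ₂ φ₂' →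
    Wnorm n h φ₁ φ₁' ≤ ρ → Wnorm n h φ₂ φ₂' ≤ ρ →
    ‖M φ₁ φ₁' - M φ₂ φ₂'‖ ≤ C * Wnorm n h (φ₁ - φ₂) (φ₁' - φ₂')

/-- **Halanay's inequality**: a scalar delay differential inequality whose undelayed damping
dominates the delayed term forces exponential convergence to the absorbing level `C / (a - b)`. -/
theorem halanay_le {y y' : ℝ → ℝ} {a b C h r K : ℝ} (hb : 0 ≤ b) (hab : b < a) (hC : 0 ≤ C)
    (hr : 0 ≤ r) (hrate : r < a - b * exp (r * h)) (hK : 0 < K) (hh : 0 ≤ h)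
    (hinit : ∀ s ∈ Icc (-h) 0, y s < K)
    (hcont : ContinuousOn y (Ici 0)) (hderiv : ∀ t > 0, HasDerivAt y (y' t) t)
    (hineq : ∀ t > 0, ∃ s ∈ Icc (t - h) t, y' t ≤ -a * y t + b * y s + C) :
    ∀ t ≥ 0, y t ≤ K * exp (-r * t) + C / (a - b) := by
  have hab' : 0 < a - b := sub_pos.2 hab
  set m := C / (a - b) with hm
  have hm0 : 0 ≤ m := by positivity
  have hmC : (a - b) * m = C := by rw [hm]; field_simp
  set W : ℝ → ℝ := fun t => K * exp (-r * t) + m with hW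
  have hWd : ∀ t, HasDerivAt W (K * (exp (-r * t) * (-r))) t := by
    intro t
    have h1 : HasDerivAt (fun t : ℝ => -r * t) (-r) t := by
      simpa using (hasDerivAt_id t).const_mul (-r)
    exact (h1.exp.const_mul K).add_const m
  have hWc : Continuous W := continuous_iff_continuousAt.2 fun t => (hWd t).continuousAt
  have hinitW : ∀ s ∈ Icc (-h) 0, y s < W s := by
    intro s hs
    have h1 : 1 ≤ exp (-r * s) := one_le_exp (by nlinarith [hs.2])
    have h2 := hinit s hs
    change y s < K * exp (-r * s) + m
    nlinarith
  intro t₁ ht₁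
  by_contra! hlt
  set S : Set ℝ := Icc 0 t₁ ∩ (fun t => y t - W t) ⁻¹' Ici 0 with hS
  have hzc : ContinuousOn (fun t => y t - W t) (Icc 0 t₁) :=
    (hcont.mono Icc_subset_Ici_self).sub hWc.continuousOn
  have hSclosed : IsClosed S := hzc.preimage_isClosed_of_isClosed isClosed_Icc isClosed_Ici
  have hScomp : IsCompact S := isCompact_Icc.of_isClosed_subset hSclosed inter_subset_left
  obtain ⟨t₀, ⟨⟨ht₀0, ht₀1⟩, ht₀⟩, hleast⟩ :=
    hScomp.exists_isLeast ⟨t₁, ⟨ht₁, le_rfl⟩, by simp only [mem_preimage, mem_Ici]; linarith⟩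
  simp only [mem_preimage, mem_Ici] at ht₀
  have hbefore : ∀ s, -h ≤ s → s < t₀ → y s < W s := by
    intro s hs hst
    rcases le_or_gt s 0 with h0 | h0
    · exact hinitW s ⟨hs, h0⟩
    · by_contra! hge
      have := hleast (show s ∈ S from ⟨⟨h0.le, by linarith⟩, by
        simp only [mem_preimage, mem_Ici]; linarith⟩)
      linarith
  have ht₀pos : 0 < t₀ := by
    rcases ht₀0.lt_or_eq with h0 | h0
    · exact h0
    · have := hinitW 0 ⟨by linarith, le_rfl⟩
      rw [← h0] at ht₀; linarith
  have hz := (hderiv t₀ ht₀pos).sub (hWd t₀)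
  have hnonneg : 0 ≤ y' t₀ - K * (exp (-r * t₀) * (-r)) := by
    refine ge_of_tendsto (hz.tendsto_slope.mono_left (nhdsLT_le_nhdsNE t₀)) ?_
    filter_upwards [Ioo_mem_nhdsLT ht₀pos] with s hs
    rw [slope_def_field]
    have h1 := hbefore s (by linarith [hs.1]) hs.2
    refine div_nonneg_of_nonpos ?_ (by linarith [hs.2])
    simp only [Pi.sub_apply]
    linarith
  obtain ⟨s, ⟨hs1, hs2⟩, hys⟩ := hineq t₀ ht₀pos
  set e := exp (-r * t₀) with he
  have he0 : 0 < e := exp_pos _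
  have hWt : W t₀ = K * e + m := rfl
  have hEone : 1 ≤ exp (r * h) := one_le_exp (by positivity)
  have hKe : 0 < K * e := by positivity
  have hbound : y' t₀ ≤ K * e * (-a + b * exp (r * h)) := by
    rcases hs2.lt_or_eq with hlt' | heq
    · have h1 := hbefore s (by linarith) hlt'
      have h2 : exp (-r * s) ≤ e * exp (r * h) := by
        rw [he, ← exp_add]; exact exp_le_exp.2 (by nlinarith)
      have h3 : y s ≤ K * (e * exp (r * h)) + m :=
        h1.le.trans (by simp only [hW]; gcongr)
      have h4 := mul_le_mul_of_nonneg_left h3 hb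
      have h5 : a * (K * e + m) ≤ a * y t₀ := by
        apply mul_le_mul_of_nonneg_left _ (by linarith); linarith
      nlinarith
    · subst heq
      have h5 : (a - b) * (K * e + m) ≤ (a - b) * y s := by
        apply mul_le_mul_of_nonneg_left _ hab'.le; linarith
      have h6 : b * (K * e) * 1 ≤ b * (K * e) * exp (r * h) := by gcongr
      nlinarith
  nlinarith

/-- A rate as required in `halanay_le` exists. -/
theorem exists_halanay_rate {a b : ℝ} (h : ℝ) (hab : b < a) :
    ∃ r > 0, r < a - b * exp (r * h) := by
  have hc : Continuous fun r : ℝ => a - b * exp (r * h) - r := by fun_prop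
  have h0 : (0 : ℝ) < (fun r : ℝ => a - b * exp (r * h) - r) 0 := by simpa using hab
  have hev := (hc.continuousAt (x := 0)).eventually (lt_mem_nhds h0)
  obtain ⟨r, hr, hr0⟩ := ((hev.filter_mono nhdsWithin_le_nhds).and
    (self_mem_nhdsWithin : Ioi (0 : ℝ) ∈ nhdsWithin 0 (Ioi 0))).exists
  exact ⟨r, hr0, by linarith⟩

/-- The primitive of a function continuous on `[0,∞)` is differentiable at positive times. -/
theorem hasDerivAt_integral_of_continuousOn_Ici {E : Type*} [NormedAddCommGroup E]
    [NormedSpace ℝ E] [CompleteSpace E] {f : ℝ → E} (hf : ContinuousOn f (Ici 0)) {t : ℝ}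
    (ht : 0 < t) : HasDerivAt (fun t => ∫ s in (0:ℝ)..t, f s) (f t) t := by
  have hs : Ici (0:ℝ) ∈ nhds t := Ici_mem_nhds ht
  refine intervalIntegral.integral_hasDerivAt_right ?_ ?_ (hf.continuousAt hs)
  · exact (hf.mono (by rw [uIcc_of_le ht.le]; exact Icc_subset_Ici_self)).intervalIntegrable
  · exact ⟨Ici 0, hs, hf.aestronglyMeasurable measurableSet_Ici⟩

theorem Wnorm_le {n : ℕ} {h B B' : ℝ} {φ φ' : ℝ → Euc n} (hh : 0 ≤ h)
    (h1 : ∀ θ ∈ Icc (-h) 0, ‖φ θ‖ ≤ B) (h2 : ∀ θ ∈ Icc (-h) 0, ‖φ' θ‖ ≤ B') :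
    Wnorm n h φ φ' ≤ B + B' := by
  have : Nonempty (Icc (-h) (0:ℝ)) := ⟨⟨0, by linarith, le_rfl⟩⟩
  exact add_le_add (ciSup_le fun θ => h1 θ.1 θ.2) (ciSup_le fun θ => h2 θ.1 θ.2)

theorem norm_le_Wnorm {n : ℕ} {h : ℝ} {φ φ' : ℝ → Euc n} (hφ : IsC1Pair n h φ φ') {θ : ℝ}
    (hθ : θ ∈ Icc (-h) 0) : ‖φ θ‖ ≤ Wnorm n h φ φ' ∧ ‖φ' θ‖ ≤ Wnorm n h φ φ' := by
  have bdd : ∀ ψ : ℝ → Euc n, ContinuousOn ψ (Icc (-h) 0) →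
      BddAbove (range fun θ : Icc (-h) (0:ℝ) => ‖ψ θ.1‖) := by
    intro ψ hψ
    obtain ⟨B, hB⟩ := isCompact_Icc.exists_bound_of_continuousOn hψ
    exact ⟨B, by rintro _ ⟨θ, rfl⟩; exact hB θ.1 θ.2⟩
  have h1 := le_ciSup (bdd φ fun x hx => (hφ.1 x hx).continuousWithinAt) ⟨θ, hθ⟩
  have h2 := le_ciSup (bdd φ' hφ.2) ⟨θ, hθ⟩
  simp only at h1 h2
  have h3 := (norm_nonneg (φ θ)).trans h1
  have h4 := (norm_nonneg (φ' θ)).trans h2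
  exact ⟨by unfold Wnorm; linarith, by unfold Wnorm; linarith⟩

/-- Segments of a `C¹` function are `C¹`. -/
theorem isC1Pair_segment {n : ℕ} {h s : ℝ} {u u' : ℝ → Euc n}
    (hu : ∀ t ∈ Ici (-h), HasDerivWithinAt u (u' t) (Ici (-h)) t)
    (hu' : ContinuousOn u' (Ici (-h))) (hs : 0 ≤ s) :
    IsC1Pair n h (fun θ => u (s + θ)) (fun θ => u' (s + θ)) := by
  have hmaps : MapsTo (fun θ => s + θ) (Icc (-h) 0) (Ici (-h)) := fun θ hθ => by
    simp only [mem_Ici]; linarith [hθ.1]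
  refine ⟨fun θ hθ => ?_, hu'.comp (by fun_prop) hmaps⟩
  have h1 : HasDerivWithinAt (fun θ => s + θ) 1 (Icc (-h) 0) θ :=
    ((hasDerivAt_id θ).const_add s).hasDerivWithinAt
  have h2 := (hu _ (hmaps hθ)).scomp θ h1 hmaps
  rw [one_smul] at h2
  exact h2

/-- A locally Lipschitz functional is continuous along the segments of a `C¹` function. -/
theorem continuousOn_along_segments {n : ℕ} {h : ℝ} (hh : 0 ≤ h)
    {τ : (ℝ → Euc n) → (ℝ → Euc n) → ℝ}
    (hτ : ∀ ρ > (0:ℝ), ∃ C > (0:ℝ), ∀ φ₁ φ₁' φ₂ φ₂' : ℝ → Euc n,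
      IsC1Pair n h φ₁ φ₁' → IsC1Pair n h φ₂ φ₂' →
      Wnorm n h φ₁ φ₁' ≤ ρ → Wnorm n h φ₂ φ₂' ≤ ρ →
      |τ φ₁ φ₁' - τ φ₂ φ₂'| ≤ C * Wnorm n h (φ₁ - φ₂) (φ₁' - φ₂'))
    {u u' : ℝ → Euc n}
    (hu : ∀ t ∈ Ici (-h), HasDerivWithinAt u (u' t) (Ici (-h)) t)
    (hu' : ContinuousOn u' (Ici (-h))) :
    ContinuousOn (fun s => τ (fun θ => u (s + θ)) (fun θ => u' (s + θ))) (Ici 0) := by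
  have huc : ContinuousOn u (Ici (-h)) := fun t ht => (hu t ht).continuousWithinAt
  intro s₀ hs₀
  simp only [mem_Ici] at hs₀
  set I := Icc (-h) (s₀ + 1) with hI
  have hsub : I ⊆ Ici (-h) := Icc_subset_Ici_self
  have hIc : IsCompact I := isCompact_Icc
  have hmem : ∀ s, 0 ≤ s → s < s₀ + 1 → ∀ θ ∈ Icc (-h) 0, s + θ ∈ I :=
    fun s h0 h1 θ hθ => ⟨by linarith [hθ.1], by linarith [hθ.2]⟩
  obtain ⟨B, hB⟩ := hIc.exists_bound_of_continuousOn (huc.mono hsub)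
  obtain ⟨B', hB'⟩ := hIc.exists_bound_of_continuousOn (hu'.mono hsub)
  have hW : ∀ s, 0 ≤ s → s < s₀ + 1 →
      Wnorm n h (fun θ => u (s + θ)) (fun θ => u' (s + θ)) ≤ |B + B'| + 1 := by
    intro s h0 h1
    have := Wnorm_le hh (fun θ hθ => hB _ (hmem s h0 h1 θ hθ))
      (fun θ hθ => hB' _ (hmem s h0 h1 θ hθ))
    linarith [le_abs_self (B + B')]
  obtain ⟨C, hC, hlip⟩ := hτ (|B + B'| + 1) (by positivity)
  have hUu := hIc.uniformContinuousOn_of_continuous (huc.mono hsub)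
  have hUu' := hIc.uniformContinuousOn_of_continuous (hu'.mono hsub)
  rw [Metric.uniformContinuousOn_iff] at hUu hUu'
  rw [Metric.continuousWithinAt_iff]
  intro ε hε
  obtain ⟨d, hd, hdu⟩ := hUu (ε / (4 * C)) (by positivity)
  obtain ⟨d', hd', hdu'⟩ := hUu' (ε / (4 * C)) (by positivity)
  refine ⟨min 1 (min d d'), by positivity, fun s hs hdist => ?_⟩
  simp only [mem_Ici] at hs
  have hlt1 : dist s s₀ < 1 := hdist.trans_le (min_le_left _ _)
  have hltd : dist s s₀ < d := hdist.trans_le ((min_le_right _ _).trans (min_le_left _ _))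
  have hltd' : dist s s₀ < d' := hdist.trans_le ((min_le_right _ _).trans (min_le_right _ _))
  have hs1 : s < s₀ + 1 := by rw [Real.dist_eq] at hlt1; linarith [(abs_lt.1 hlt1).2]
  have hs01 : s₀ < s₀ + 1 := by linarith
  have hdd : ∀ θ, dist (s + θ) (s₀ + θ) = dist s s₀ := fun θ => by simp
  have key := hlip _ _ _ _ (isC1Pair_segment hu hu' hs) (isC1Pair_segment hu hu' hs₀)
    (hW s hs hs1) (hW s₀ hs₀ hs01)
  have hdiff := Wnorm_le (φ := (fun θ => u (s + θ)) - fun θ => u (s₀ + θ))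
    (φ' := (fun θ => u' (s + θ)) - fun θ => u' (s₀ + θ)) (B := ε / (4 * C)) (B' := ε / (4 * C)) hh
    (fun θ hθ => by
      have := hdu _ (hmem s hs hs1 θ hθ) _ (hmem s₀ hs₀ hs01 θ hθ) (by rwa [hdd])
      rw [dist_eq_norm] at this
      exact this.le)
    (fun θ hθ => by
      have := hdu' _ (hmem s hs hs1 θ hθ) _ (hmem s₀ hs₀ hs01 θ hθ) (by rwa [hdd])
      rw [dist_eq_norm] at this
      exact this.le)
  rw [Real.dist_eq]
  refine key.trans_lt ((mul_le_mul_of_nonneg_left hdiff hC.le).trans_lt ?_)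
  have : C * (ε / (4 * C) + ε / (4 * C)) = ε / 2 := by field_simp; ring
  rw [this]; linarith

/-- With a locally Lipschitz delay, the velocity of a mild solution is differentiable at positive
times and the equation holds pointwise. -/
theorem IsGlobalMildSol.hasDerivAt_velocity {n : ℕ} {h k : ℝ} (hh : 0 ≤ h)
    {A : Euc n →L[ℝ] Euc n} {F G : Euc n → Euc n} (hF : Continuous F) (hG : Continuous G)
    {τ : (ℝ → Euc n) → (ℝ → Euc n) → ℝ}
    (hτ_mem : ∀ φ φ' : ℝ → Euc n, IsC1Pair n h φ φ' → τ φ φ' ∈ Icc (0:ℝ) h)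
    (hτ : ∀ ρ > (0:ℝ), ∃ C > (0:ℝ), ∀ φ₁ φ₁' φ₂ φ₂' : ℝ → Euc n,
      IsC1Pair n h φ₁ φ₁' → IsC1Pair n h φ₂ φ₂' →
      Wnorm n h φ₁ φ₁' ≤ ρ → Wnorm n h φ₂ φ₂' ≤ ρ →
      |τ φ₁ φ₁' - τ φ₂ φ₂'| ≤ C * Wnorm n h (φ₁ - φ₂) (φ₁' - φ₂'))
    {φ φ' u u' : ℝ → Euc n}
    (hsol : IsGlobalMildSol n h k A F (fun ψ ψ' => G (ψ (-(τ ψ ψ')))) φ φ' u u')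
    {t : ℝ} (ht : 0 < t) :
    ∃ s ∈ Icc (t - h) t,
      HasDerivAt u' (-(k • u' t + A (u t) + F (u t) + G (u s))) t := by
  obtain ⟨hu, hu', -, hint⟩ := hsol
  have huc : ContinuousOn u (Ici (-h)) := fun t ht => (hu t ht).continuousWithinAt
  have hsub : Ici (0:ℝ) ⊆ Ici (-h) := Ici_subset_Ici.2 (by linarith)
  set d : ℝ → ℝ := fun s => τ (fun θ => u (s + θ)) (fun θ => u' (s + θ)) with hd
  have hdc : ContinuousOn d (Ici 0) := continuousOn_along_segments hh hτ hu hu'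
  have hdmem : ∀ s, 0 ≤ s → d s ∈ Icc 0 h := fun s hs =>
    hτ_mem _ _ (isC1Pair_segment hu hu' hs)
  have hdelay : ContinuousOn (fun s => u (s + -d s)) (Ici 0) :=
    huc.comp (continuousOn_id.add hdc.neg) fun s hs => by
      simp only [mem_Ici] at hs ⊢
      linarith [(hdmem s hs).2]
  have hf : ContinuousOn (fun s => k • u' s + A (u s) + F (u s) + G (u (s + -d s))) (Ici 0) :=
    ((((hu'.mono hsub).const_smul k).add (A.continuous.comp_continuousOn (huc.mono hsub))).add
      (hF.comp_continuousOn (huc.mono hsub))).add (hG.comp_continuousOn hdelay)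
  refine ⟨t + -d t, ⟨by linarith [(hdmem t ht.le).2], by linarith [(hdmem t ht.le).1]⟩, ?_⟩
  have h1 := (hasDerivAt_integral_of_continuousOn_Ici hf ht).const_sub (φ' 0)
  refine h1.congr_of_eventuallyEq ?_
  filter_upwards [Ici_mem_nhds ht] with s hs
  exact hint s hs

/-- The energy `½‖w‖² + ½⟨Ax,x⟩ + Π(x)` perturbed by the cross term `γ⟨x,w⟩`. -/
def lyapunov {n : ℕ} (A : Euc n →L[ℝ] Euc n) (Pot : Euc n → ℝ) (γ : ℝ) (x w : Euc n) : ℝ :=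
  (1 / 2) * ‖w‖ ^ 2 + (1 / 2) * ⟪A x, x⟫ + Pot x + γ * ⟪x, w⟫

theorem ContinuousOn.lyapunov {n : ℕ} {X : Type*} [TopologicalSpace X] (A : Euc n →L[ℝ] Euc n)
    {Pot : Euc n → ℝ} (hPot : Continuous Pot) (γ : ℝ) {x w : X → Euc n} {S : Set X}
    (hx : ContinuousOn x S) (hw : ContinuousOn w S) :
    ContinuousOn (fun t => lyapunov A Pot γ (x t) (w t)) S := by
  have hPx : ContinuousOn (fun t => Pot (x t)) S := hPot.comp_continuousOn hx
  have hAx : ContinuousOn (fun t => A (x t)) S := A.continuous.comp_continuousOn hx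
  unfold _root_.lyapunov
  exact (((continuousOn_const.mul (hw.norm.pow 2)).add
    (continuousOn_const.mul (hAx.inner hx))).add hPx).add (continuousOn_const.mul (hx.inner hw))

theorem hasDerivAt_lyapunov {n : ℕ} {A : Euc n →L[ℝ] Euc n}
    (hA : ∀ x y : Euc n, ⟪A x, y⟫ = ⟪x, A y⟫) {Pot : Euc n → ℝ} {γ t : ℝ} {u u' : ℝ → Euc n}
    {w' p : Euc n} (hu : HasDerivAt u (u' t) t) (hu' : HasDerivAt u' w' t)
    (hPot : HasGradientAt Pot p (u t)) :
    HasDerivAt (fun t => lyapunov A Pot γ (u t) (u' t))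
      (⟪u' t, w'⟫ + ⟪A (u t), u' t⟫ + ⟪p, u' t⟫ + γ * (‖u' t‖ ^ 2 + ⟪u t, w'⟫)) t := by
  have h1 := (hu'.norm_sq).const_mul (1 / 2 : ℝ)
  have h2 := ((A.hasFDerivAt.comp_hasDerivAt t hu).inner ℝ hu).const_mul (1 / 2 : ℝ)
  have h3 : HasDerivAt (fun t => Pot (u t)) ⟪p, u' t⟫ t := by
    have h := hPot.hasFDerivAt.comp_hasDerivAt t hu
    rw [InnerProductSpace.toDual_apply_apply] at h
    exact h
  have h4 := (hu.inner ℝ hu').const_mul γ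
  refine (((h1.add h2).add h3).add h4).congr_deriv ?_
  simp only [Function.comp_apply]
  rw [hA (u' t) (u t), real_inner_comm (A (u t)) (u' t), real_inner_self_eq_norm_sq]
  ring

/-- Young's inequality for the derivative of the perturbed energy along `ẇ = -(kw + a + f + g)`;
here `a`, `f`, `g` are the elastic, nonlinear and delayed forces and `f - s` is the potential
part of `f`. -/
theorem perturbed_energy_rate_le {E : Type*} [NormedAddCommGroup E] [InnerProductSpace ℝ E]
    {k₀ k γ : ℝ} (hk₀ : 0 < k₀) (hk : k₀ ≤ k) (hγ : 0 < γ) (hγ1 : γ ≤ 1) (hγk : γ ≤ k₀ ^ 2 / 8)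
    (x w a f s g : E) :
    ⟪w, -(k • w + a + f + g)⟫ + ⟪a, w⟫ + ⟪f - s, w⟫ +
        γ / k * (‖w‖ ^ 2 + ⟪x, -(k • w + a + f + g)⟫) ≤
      1 / k * (-γ * (‖w‖ ^ 2 + ⟪a, x⟫ + ⟪x, f⟫) + ‖s‖ ^ 2 + 2 * ‖g‖ ^ 2 + 2 * ‖x‖ ^ 2) := by
  have hk0 : 0 < k := hk₀.trans_le hk
  have young : ∀ c : ℝ, ∀ p q : E, 0 ≤ c ^ 2 * ‖p‖ ^ 2 + 2 * c * ⟪p, q⟫ + ‖q‖ ^ 2 := by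
    intro c p q
    have h := sq_nonneg ‖c • p + q‖
    rw [norm_add_sq_real, norm_smul, inner_smul_left, mul_pow, Real.norm_eq_abs, sq_abs] at h
    simp only [conj_trivial] at h
    linarith
  have y1 := young (k / 2) w s
  have y2 := young (k / 2) w g
  have y3 := young (k / 2) w (γ • x)
  have y4 := mul_nonneg hγ.le (young 1 x g)
  rw [inner_smul_right, norm_smul, mul_pow, Real.norm_eq_abs, sq_abs] at y3
  rw [div_mul_eq_mul_div, one_div, ← div_eq_inv_mul, le_div_iff₀ hk0, add_mul,
    div_mul_cancel₀ _ hk0.ne']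
  simp only [inner_neg_right, inner_add_right, inner_smul_right, inner_sub_left,
    real_inner_self_eq_norm_sq]
  rw [real_inner_comm w a, real_inner_comm w f, real_inner_comm w s, real_inner_comm x a,
    real_inner_comm w x]
  have hkk : γ ≤ k ^ 2 / 8 := by nlinarith
  have hv : 0 ≤ (k ^ 2 / 8 - γ) * ‖w‖ ^ 2 := mul_nonneg (by linarith) (by positivity)
  have hx : 0 ≤ (1 - γ) * ‖x‖ ^ 2 := mul_nonneg (by linarith) (by positivity)
  have hg : 0 ≤ (1 - γ) * ‖g‖ ^ 2 := mul_nonneg (by linarith) (by positivity)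
  have hx2 : 0 ≤ γ * (1 - γ) * ‖x‖ ^ 2 :=
    mul_nonneg (mul_nonneg hγ.le (by linarith)) (by positivity)
  nlinarith

/-- The perturbed energy is equivalent, up to a constant, to `‖w‖² + ⟨Ax,x⟩ + Π₀(x)`. -/
theorem lyapunov_bounds {n : ℕ} {A : Euc n →L[ℝ] Euc n} {Pot Pot0 Pot1 : Euc n → ℝ}
    (hA : ∀ x, 0 ≤ ⟪A x, x⟫) (hPot_split : ∀ x, Pot x = Pot0 x + Pot1 x)
    (hPot0 : ∀ x, 0 ≤ Pot0 x) {C₁ C₂ : ℝ} (hC₂ : 0 ≤ C₂)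
    (hC₁b : ∀ x, |Pot1 x| ≤ 1 / 4 * (⟪A x, x⟫ + Pot0 x) + C₁)
    (hC₂b : ∀ x, ‖x‖ ^ 2 ≤ C₂ + 1 * (⟪A x, x⟫ + Pot0 x)) {γ : ℝ} (hγ0 : 0 ≤ γ)
    (hγ : γ ≤ 1 / 4) (x w : Euc n) :
    ‖w‖ ^ 2 + ⟪A x, x⟫ + Pot0 x ≤ 8 * (lyapunov A Pot γ x w + (C₁ + C₂)) ∧
      lyapunov A Pot γ x w ≤ 2 * (‖w‖ ^ 2 + ⟪A x, x⟫ + Pot0 x) + (C₁ + C₂) := by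
  have h1 := abs_le.1 (hC₁b x)
  have h2 := hC₂b x
  have h3 := hA x
  have h4 := hPot0 x
  have hv := sq_nonneg ‖w‖
  have h5 : |γ * ⟪x, w⟫| ≤ 1 / 8 * (‖w‖ ^ 2 + ‖x‖ ^ 2) := by
    rw [abs_mul, abs_of_nonneg hγ0]
    have h6 := abs_real_inner_le_norm x w
    have h7 : γ * |⟪x, w⟫| ≤ 1 / 4 * (‖x‖ * ‖w‖) :=
      mul_le_mul hγ h6 (abs_nonneg _) (by norm_num)
    nlinarith [sq_nonneg (‖x‖ - ‖w‖)]
  have h8 := abs_le.1 h5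
  have h9 := hPot_split x
  unfold lyapunov
  constructor <;> linarith [h1.1, h1.2, h8.1, h8.2]

/-- The uniform Lyapunov estimate: with cross-term coefficient `γ/k` the perturbed energy controls
the energy norm and satisfies a delay differential inequality whose coefficients scale like `1/k`,
uniformly for `k ≥ k₀`. -/
theorem exists_uniform_lyapunov_estimate {n : ℕ} {A : Euc n →L[ℝ] Euc n}
    (hA : ∀ x, 0 ≤ ⟪A x, x⟫) {F : Euc n → Euc n} {Pot Pot0 Pot1 : Euc n → ℝ}
    {Fstar : Euc n → Euc n} (hPot_split : ∀ x, Pot x = Pot0 x + Pot1 x)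
    (hPot0 : ∀ x, 0 ≤ Pot0 x)
    (hPot1 : ∀ η > (0:ℝ), ∃ C > (0:ℝ), ∀ x : Euc n, |Pot1 x| ≤ η * (⟪A x, x⟫ + Pot0 x) + C)
    (hF3a : ∃ η c₄ c₅ : ℝ, 0 ≤ η ∧ η < 1 ∧ 0 < c₄ ∧ 0 < c₅ ∧
      ∀ x : Euc n, -⟪x, F x⟫ ≤ η * ⟪A x, x⟫ - c₄ * Pot0 x + c₅)
    (hF3b : ∀ η' > (0:ℝ), ∃ C > (0:ℝ), ∀ x : Euc n, ‖x‖^2 ≤ C + η' * (⟪A x, x⟫ + Pot0 x))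
    (hF3c : ∃ c₆ c₇ : ℝ, 0 ≤ c₆ ∧ 0 ≤ c₇ ∧ ∀ x : Euc n, ‖Fstar x‖^2 ≤ c₆ + c₇ * ‖x‖^2)
    {G : Euc n → Euc n} {L : NNReal} (hG : LipschitzWith L G) {k₀ : ℝ} (hk₀ : 0 < k₀) :
    ∃ γ a b C D : ℝ, 0 ≤ b ∧ b < a ∧ 0 ≤ C ∧ ∀ k, k₀ ≤ k →
      (∀ x w, ‖w‖ ^ 2 + ⟪A x, x⟫ ≤ 8 * (lyapunov A Pot (γ / k) x w + D)) ∧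
      ∀ x w y z, ⟪w, -(k • w + A x + F x + G y)⟫ + ⟪A x, w⟫ + ⟪F x - Fstar x, w⟫ +
          γ / k * (‖w‖ ^ 2 + ⟪x, -(k • w + A x + F x + G y)⟫) ≤
        1 / k * (-a * lyapunov A Pot (γ / k) x w + b * lyapunov A Pot (γ / k) y z + C) := by
  obtain ⟨η, c₄, c₅, -, hη1, hc₄, hc₅, hFx⟩ := hF3a
  obtain ⟨c₆, c₇, hc₆, hc₇, hFs⟩ := hF3c
  obtain ⟨C₁, hC₁, hC₁b⟩ := hPot1 (1 / 4) (by norm_num)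
  obtain ⟨C₂, hC₂, hC₂b⟩ := hF3b 1 one_pos
  set γ := min 1 (min (k₀ / 4) (k₀ ^ 2 / 8)) with hγdef
  have hγ : 0 < γ := by positivity
  have hγ1 : γ ≤ 1 := min_le_left _ _
  have hγ2 : γ ≤ k₀ / 4 := (min_le_right _ _).trans (min_le_left _ _)
  have hγ3 : γ ≤ k₀ ^ 2 / 8 := (min_le_right _ _).trans (min_le_right _ _)
  set μ := min (min (1 - η) c₄) 1 with hμdef
  have hμ : 0 < μ := lt_min (lt_min (by linarith) hc₄) one_pos
  have hμ1 : μ ≤ 1 - η := (min_le_left _ _).trans (min_le_left _ _)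
  have hμ2 : μ ≤ c₄ := (min_le_left _ _).trans (min_le_right _ _)
  have hμ3 : μ ≤ 1 := min_le_right _ _
  set β := γ * μ with hβdef
  have hβ : 0 < β := mul_pos hγ hμ
  have hL : (0:ℝ) ≤ L := L.2
  set Q := 2 * (c₇ + 2) + 256 * (L : ℝ) ^ 2 with hQdef
  have hQ : 0 < Q := by positivity
  set ε := β / Q with hεdef
  have hε : 0 < ε := div_pos hβ hQ
  have hεQ : ε * Q = β := div_mul_cancel₀ _ hQ.ne'
  have hL2 : 0 ≤ ε * (L : ℝ) ^ 2 := by positivity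
  have hc7 : 0 ≤ ε * (c₇ + 2) := by positivity
  have hε1 : (c₇ + 2) * ε ≤ β / 2 := by rw [hQdef] at hεQ; nlinarith
  have hε2 : 32 * (L : ℝ) ^ 2 * ε ≤ β / 8 := by rw [hQdef] at hεQ; nlinarith
  obtain ⟨C₃, hC₃, hC₃b⟩ := hF3b ε hε
  set D := C₁ + C₂ with hDdef
  set b := 32 * (L : ℝ) ^ 2 * ε with hbdef
  have hb : 0 ≤ b := by positivity
  set C₀ := γ * c₅ + c₆ + 4 * ‖G 0‖ ^ 2 + (c₇ + 2) * C₃ + 4 * (L : ℝ) ^ 2 * C₃ with hC₀def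
  refine ⟨γ, β / 4, b, β / 4 * D + b * D + C₀, D, hb, by linarith, by positivity, ?_⟩
  intro k hk
  have hk0 : 0 < k := hk₀.trans_le hk
  have hγk : γ / k ≤ 1 / 4 := by rw [div_le_iff₀ hk0]; linarith
  have hbd := fun x w => lyapunov_bounds (Pot := Pot) hA hPot_split hPot0 hC₂.le hC₁b hC₂b
    (div_pos hγ hk0).le hγk x w
  refine ⟨fun x w => by linarith [(hbd x w).1, hPot0 x], fun x w y z => ?_⟩
  refine (perturbed_energy_rate_le hk₀ hk hγ hγ1 hγ3 x w (A x) (F x) (Fstar x) (G y)).trans ?_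
  refine mul_le_mul_of_nonneg_left ?_ (by positivity)
  have hV := (hbd x w).2
  have hVd := (hbd y z).1
  set V := lyapunov A Pot (γ / k) x w
  set Vd := lyapunov A Pot (γ / k) y z
  have hGy : ‖G y‖ ^ 2 ≤ 2 * (L : ℝ) ^ 2 * ‖y‖ ^ 2 + 2 * ‖G 0‖ ^ 2 := by
    have h1 : ‖G y - G 0‖ ≤ L * ‖y‖ := by simpa using hG.norm_sub_le y 0
    have h2 : ‖G y‖ ≤ L * ‖y‖ + ‖G 0‖ := by
      have := norm_le_norm_add_norm_sub' (G y) (G 0)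
      linarith
    have h3 : ‖G y‖ ^ 2 ≤ (L * ‖y‖ + ‖G 0‖) ^ 2 := by gcongr
    nlinarith [sq_nonneg (L * ‖y‖ - ‖G 0‖)]
  set v := ‖w‖ ^ 2
  set e := ⟪A x, x⟫
  set P := Pot0 x
  have hv : 0 ≤ v := sq_nonneg _
  have he : 0 ≤ e := hA x
  have hP : 0 ≤ P := hPot0 x
  set S := v + e + P with hS
  set Sd := ‖z‖ ^ 2 + ⟪A y, y⟫ + Pot0 y with hSd
  have hx : ‖x‖ ^ 2 ≤ C₃ + ε * S :=
    (hC₃b x).trans (by gcongr; rw [hS]; linarith)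
  have hy : ‖y‖ ^ 2 ≤ C₃ + ε * Sd :=
    (hC₃b y).trans (by gcongr; rw [hSd]; linarith [sq_nonneg ‖z‖])
  have hcoer : -γ * (v + e + ⟪x, F x⟫) ≤ -(β * S) + γ * c₅ := by
    have h1 := mul_le_mul_of_nonneg_left (hFx x) hγ.le
    have h2 : 0 ≤ γ * ((1 - μ) * v + (1 - η - μ) * e + (c₄ - μ) * P) := by
      have := mul_nonneg (sub_nonneg.2 hμ3) hv
      have := mul_nonneg (sub_nonneg.2 hμ1) he
      have := mul_nonneg (sub_nonneg.2 hμ2) hP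
      positivity
    rw [hβdef, hS]
    linarith
  have h1 : (c₇ + 2) * ‖x‖ ^ 2 ≤ (c₇ + 2) * C₃ + β / 2 * S := by
    have := mul_le_mul_of_nonneg_left hx (by linarith : 0 ≤ c₇ + 2)
    have := mul_le_mul_of_nonneg_right hε1 (by linarith : 0 ≤ S)
    linarith
  have h2 : 4 * (L : ℝ) ^ 2 * ‖y‖ ^ 2 ≤ 4 * (L : ℝ) ^ 2 * C₃ + b * (Vd + D) := by
    have h3 := mul_le_mul_of_nonneg_left hy (by positivity : 0 ≤ 4 * (L : ℝ) ^ 2)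
    have h4 := mul_le_mul_of_nonneg_left hVd (by positivity : 0 ≤ 4 * (L : ℝ) ^ 2 * ε)
    rw [hbdef]
    linarith
  have h3 := mul_le_mul_of_nonneg_left hV hβ.le
  have h4 := hFs x
  linarith

/-- uniform dissipativity of the system with discrete state-dependent
delay `M(φ) = G(φ(-τ(φ)))`, for `k ≥ k₀` and small delay time `h ∈ (0,h₀]`. -/
theorem dissipativity
    (n : ℕ) (hn : 1 ≤ n)
    (A : Euc n →L[ℝ] Euc n)
    (hA_symm : ∀ x y : Euc n, ⟪A x, y⟫ = ⟪x, A y⟫)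
    (hA_pos : ∀ x : Euc n, x ≠ 0 → 0 < ⟪A x, x⟫)
    (F : Euc n → Euc n) (hF1 : LocallyLipschitz F)
    -- Hypothesis (F2)
    (Pot Pot0 Pot1 : Euc n → ℝ) (Fstar : Euc n → Euc n)
    (hPot_smooth : ContDiff ℝ 1 Pot)
    (hF_grad : ∀ x : Euc n, HasGradientAt Pot (F x - Fstar x) x)
    (L_Fstar : NNReal) (hFstar_lip : LipschitzWith L_Fstar Fstar)
    (hPot_split : ∀ x, Pot x = Pot0 x + Pot1 x)
    (hPot0_nonneg : ∀ x, 0 ≤ Pot0 x)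
    (hPot1_bound : ∀ η > (0:ℝ), ∃ C > (0:ℝ), ∀ x : Euc n,
      |Pot1 x| ≤ η * (⟪A x, x⟫ + Pot0 x) + C)
    -- Hypothesis (F3)
    (hF3a : ∃ η c₄ c₅ : ℝ, 0 ≤ η ∧ η < 1 ∧ 0 < c₄ ∧ 0 < c₅ ∧
      ∀ x : Euc n, -⟪x, F x⟫ ≤ η * ⟪A x, x⟫ - c₄ * Pot0 x + c₅)
    (hF3b : ∀ η' > (0:ℝ), ∃ C > (0:ℝ), ∀ x : Euc n, ‖x‖^2 ≤ C + η' * (⟪A x, x⟫ + Pot0 x))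
    (hF3c : ∃ c₆ c₇ : ℝ, 0 ≤ c₆ ∧ 0 ≤ c₇ ∧ ∀ x : Euc n, ‖Fstar x‖^2 ≤ c₆ + c₇ * ‖x‖^2)
    -- Hypothesis (M3): `M(φ) = G(φ(-τ(φ)))` with `G` globally Lipschitz
    (G : Euc n → Euc n) (L_G : NNReal) (hG_lip : LipschitzWith L_G G)
    :
    ∀ k₀ > (0:ℝ), ∃ h₀ > (0:ℝ), ∃ R > (0:ℝ), ∀ k : ℝ, k₀ ≤ k → ∀ h : ℝ, 0 < h → h ≤ h₀ →
      ∀ τ : (ℝ → Euc n) → (ℝ → Euc n) → ℝ,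
        (∀ φ φ' : ℝ → Euc n, IsC1Pair n h φ φ' → τ φ φ' ∈ Icc (0:ℝ) h) →
        (∀ ρ > (0:ℝ), ∃ C > (0:ℝ), ∀ φ₁ φ₁' φ₂ φ₂' : ℝ → Euc n,
          IsC1Pair n h φ₁ φ₁' → IsC1Pair n h φ₂ φ₂' →
          Wnorm n h φ₁ φ₁' ≤ ρ → Wnorm n h φ₂ φ₂' ≤ ρ →
          |τ φ₁ φ₁' - τ φ₂ φ₂'| ≤ C * Wnorm n h (φ₁ - φ₂) (φ₁' - φ₂')) →
        ∀ ρ > (0:ℝ), ∃ t_ρ ≥ (0:ℝ), ∀ φ φ' u u' : ℝ → Euc n,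
          IsC1Pair n h φ φ' → Wnorm n h φ φ' ≤ ρ →
          IsGlobalMildSol n h k A F (fun ψ ψ' => G (ψ (-(τ ψ ψ')))) φ φ' u u' →
          ∀ t ≥ t_ρ, ‖u' t‖^2 + ⟪A (u t), u t⟫ ≤ R^2 := by
  intro k₀ hk₀
  have hA0 : ∀ x, 0 ≤ ⟪A x, x⟫ := fun x => by
    rcases eq_or_ne x 0 with rfl | hx
    · simp
    · exact (hA_pos x hx).le
  obtain ⟨γ, a, b, C, D, hb, hab, hC, hest⟩ := exists_uniform_lyapunov_estimate (Pot := Pot) hA0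
    hPot_split hPot0_nonneg hPot1_bound hF3a hF3b hF3c hG_lip hk₀
  have hR : 0 < |8 * (1 + C / (a - b) + D)| + 1 := by positivity
  refine ⟨1, one_pos, √(|8 * (1 + C / (a - b) + D)| + 1), Real.sqrt_pos.2 hR, ?_⟩
  intro k hk h hh _ τ hτ_mem hτ_lip ρ hρ
  have hk0 : 0 < k := hk₀.trans_le hk
  obtain ⟨hcoer, hrate⟩ := hest k hk
  set V := lyapunov A Pot (γ / k)
  obtain ⟨K, hK⟩ := ((isCompact_closedBall (0 : Euc n) ρ).prod
    (isCompact_closedBall (0 : Euc n) ρ)).exists_bound_of_continuousOn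
      (ContinuousOn.lyapunov A hPot_smooth.continuous (γ / k) continuousOn_fst continuousOn_snd)
  obtain ⟨r, hr, hrlt⟩ := exists_halanay_rate h (div_lt_div_of_pos_right hab hk0)
  have hKpos : 0 < |K| + 1 := by positivity
  have hlim : Filter.Tendsto (fun t => (|K| + 1) * exp (-r * t)) Filter.atTop (nhds 0) := by
    have h1 : Filter.Tendsto (fun t => exp (-r * t)) Filter.atTop (nhds 0) :=
      tendsto_exp_atBot.comp (Filter.tendsto_id.const_mul_atTop_of_neg (neg_lt_zero.2 hr))
    simpa using h1.const_mul (|K| + 1)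
  obtain ⟨T, hT⟩ := Filter.eventually_atTop.1 (hlim.eventually (gt_mem_nhds one_pos))
  refine ⟨max T 0, le_max_right _ _, ?_⟩
  intro φ φ' u u' hφ hφρ hsol t ht
  obtain ⟨hu, hu', hinit, -⟩ := id hsol
  have huc : ContinuousOn u (Ici (-h)) := fun t ht => (hu t ht).continuousWithinAt
  have hsub : Ici (0:ℝ) ⊆ Ici (-h) := Ici_subset_Ici.2 (by linarith)
  choose! d hd hacc using fun (t : ℝ) (ht : 0 < t) => hsol.hasDerivAt_velocity hh.le
    hF1.continuous hG_lip.continuous hτ_mem hτ_lip ht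
  have hbefore : ∀ s ∈ Icc (-h) 0, V (u s) (u' s) < |K| + 1 := fun s hs => by
    have h1 := norm_le_Wnorm hφ hs
    obtain ⟨e1, e2⟩ := hinit s hs
    have h2 := hK (u s, u' s) ⟨by simpa [e1] using h1.1.trans hφρ,
      by simpa [e2] using h1.2.trans hφρ⟩
    have h3 : V (u s) (u' s) ≤ |K| := (le_abs_self _).trans (h2.trans (le_abs_self K))
    linarith
  have hVu : ContinuousOn (fun t => V (u t) (u' t)) (Ici 0) :=
    ContinuousOn.lyapunov A hPot_smooth.continuous _ (huc.mono hsub) (hu'.mono hsub)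
  set w : ℝ → Euc n := fun t => -(k • u' t + A (u t) + F (u t) + G (u (d t)))
  set V' : ℝ → ℝ := fun t => ⟪u' t, w t⟫ + ⟪A (u t), u' t⟫ + ⟪F (u t) - Fstar (u t), u' t⟫ +
    γ / k * (‖u' t‖ ^ 2 + ⟪u t, w t⟫)
  have hdV : ∀ t > 0, HasDerivAt (fun t => V (u t) (u' t)) (V' t) t := fun t ht =>
    hasDerivAt_lyapunov hA_symm
      ((hu t (by simp only [mem_Ici]; linarith)).hasDerivAt (Ici_mem_nhds (by linarith)))
      (hacc t ht) (hF_grad (u t))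
  have hineq : ∀ t > 0, ∃ s ∈ Icc (t - h) t,
      V' t ≤ -(a / k) * V (u t) (u' t) + b / k * V (u s) (u' s) + C / k := fun t ht =>
    ⟨d t, hd t ht, (hrate (u t) (u' t) (u (d t)) (u' (d t))).trans_eq (by ring)⟩
  have hdecay := halanay_le (div_nonneg hb hk0.le) (div_lt_div_of_pos_right hab hk0)
    (div_nonneg hC hk0.le) hr.le hrlt hKpos hh.le hbefore hVu hdV hineq t
    ((le_max_right _ _).trans ht)
  have hm : C / k / (a / k - b / k) = C / (a - b) := by
    have : a - b ≠ 0 := by linarith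
    field_simp
  rw [hm] at hdecay
  have h1 := hT t ((le_max_left _ _).trans ht)
  rw [Real.sq_sqrt hR.le]
  have h2 := hcoer (u t) (u' t)
  have h3 := le_abs_self (8 * (1 + C / (a - b) + D))
  linarith
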